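/- (Covariance of the quantum α = 0 time-slice action under the quantum Ito formula) Fix x₀ ∈ U, Δt > 0 and Δx ∈ ℝ^d, and define the quantum-Ito-transformed increment Δy^a = (∂φ^a/∂x^i)(x₀) Δx^i + (ħ/(2m)) g^{ij}(x₀) (∂²φ^a/∂x^i ∂x^j)(x₀) Δt. Then: (a) Δy^a − Q'^a(φ(x₀)) Δt = (∂φ^a/∂x^i)(x₀) ( Δx^i − Q^i(x₀) Δt ) for each a; and (b) the α = 0 quantum time-slice action is invariant: ( Δy^a − Q'^a Δt ) (m g'_{ab}(φ(x₀))/(2ħΔt)) ( Δy^b − Q'^b Δt ) + (Δt/ħ) V'(φ(x₀)) = ( Δx^i − Q^i Δt ) (m g_{ij}(x₀)/(2ħΔt)) ( Δx^j − Q^j Δt ) + (Δt/ħ) V(x₀). -/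

import Mathlib

open Real

/-- Partial derivative `∂_k f` of a scalar field on `ℝ^d`, at a point. -/
noncomputable def pd {d : ℕ} (f : (Fin d → ℝ) → ℝ) (k : Fin d) (x : Fin d → ℝ) : ℝ :=
  fderiv ℝ f x (Pi.single k 1)

/-- Second partial derivative `∂_i ∂_j f` of a scalar field on `ℝ^d`, at a point. -/
noncomputable def pd2 {d : ℕ} (f : (Fin d → ℝ) → ℝ) (i j : Fin d) (x : Fin d → ℝ) : ℝ :=
  pd (fun y => pd f j y) i x

/-- The transformed (covariant) metric
`g'_{ab}(y) = (∂ψ^i/∂y^a) g_{ij}(ψ(y)) (∂ψ^j/∂y^b)`. -/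
noncomputable def metricP (d : ℕ) (ψ : (Fin d → ℝ) → (Fin d → ℝ))
    (g : (Fin d → ℝ) → Matrix (Fin d) (Fin d) ℝ)
    (y : Fin d → ℝ) : Matrix (Fin d) (Fin d) ℝ :=
  Matrix.of fun a b => ∑ i, ∑ j,
    pd (fun z => ψ z i) a y * g (ψ y) i j * pd (fun z => ψ z j) b y

/-- The quantum spurious drift
`Q^i(x) = (hbar/(2m)) (1/√det g) ∂_k(√det g g^{ik})(x)`. -/
noncomputable def quantumDrift (d : ℕ) (hbar m : ℝ)
    (g : (Fin d → ℝ) → Matrix (Fin d) (Fin d) ℝ)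
    (x : Fin d → ℝ) (i : Fin d) : ℝ :=
  (hbar / (2 * m)) * (Real.sqrt (g x).det)⁻¹ *
    ∑ k, pd (fun z => Real.sqrt (g z).det * (g z)⁻¹ i k) k x

section PartialDerivatives

open Filter Topology

variable {d : ℕ} {x : Fin d → ℝ}

theorem pd_congr {f h : (Fin d → ℝ) → ℝ} (hfh : f =ᶠ[𝓝 x] h) (k : Fin d) :
    pd f k x = pd h k x := by
  rw [pd, pd, hfh.fderiv_eq]

theorem pd_mul {f h : (Fin d → ℝ) → ℝ} (hf : DifferentiableAt ℝ f x)
    (hh : DifferentiableAt ℝ h x) (k : Fin d) :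
    pd (fun z => f z * h z) k x = pd f k x * h x + f x * pd h k x := by
  simp only [pd]
  rw [fderiv_fun_mul hf hh]
  simp only [add_apply, smul_apply, smul_eq_mul]
  ring

theorem pd_const_mul (c : ℝ) {f : (Fin d → ℝ) → ℝ} (hf : DifferentiableAt ℝ f x) (k : Fin d) :
    pd (fun z => c * f z) k x = c * pd f k x := by
  simp only [pd]
  rw [fderiv_const_mul hf]
  simp

theorem pd_sum {ι : Type*} {s : Finset ι} {f : ι → (Fin d → ℝ) → ℝ}
    (hf : ∀ i ∈ s, DifferentiableAt ℝ (f i) x) (k : Fin d) :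
    pd (fun z => ∑ i ∈ s, f i z) k x = ∑ i ∈ s, pd (f i) k x := by
  simp only [pd]
  rw [fderiv_fun_sum hf]
  simp

theorem pd_comp {f : (Fin d → ℝ) → ℝ} {ψ : (Fin d → ℝ) → (Fin d → ℝ)}
    (hf : DifferentiableAt ℝ f (ψ x)) (hψ : DifferentiableAt ℝ ψ x) (k : Fin d) :
    pd (fun z => f (ψ z)) k x = ∑ j, pd f j (ψ x) * pd (fun z => ψ z j) k x := by
  have hcomp : pd (fun z => f (ψ z)) k x
      = fderiv ℝ f (ψ x) (fderiv ℝ ψ x (Pi.single k 1)) := by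
    change fderiv ℝ (f ∘ ψ) x _ = _
    rw [fderiv_comp x hf hψ]
    rfl
  have hcoord : ∀ j, pd (fun z => ψ z j) k x = fderiv ℝ ψ x (Pi.single k 1) j := by
    intro j
    rw [pd, fderiv_apply hψ j]
    rfl
  rw [hcomp]
  conv_lhs => rw [pi_eq_sum_univ' (fderiv ℝ ψ x (Pi.single k 1))]
  simp only [map_sum, map_smul, smul_eq_mul, hcoord]
  refine Finset.sum_congr rfl fun j _ => ?_
  rw [mul_comm]
  congr 2

theorem pd_coord (i k : Fin d) :
    pd (fun z : Fin d → ℝ => z i) k x = (1 : Matrix (Fin d) (Fin d) ℝ) i k := by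
  have h : HasFDerivAt (fun z : Fin d → ℝ => z i)
      (ContinuousLinearMap.proj (R := ℝ) (φ := fun _ => ℝ) i) x :=
    hasFDerivAt_apply i x
  rw [pd, h.fderiv]
  simp [Pi.single_apply, Matrix.one_apply]

theorem contDiffAt_pd {f : (Fin d → ℝ) → ℝ} {n : WithTop ℕ∞} (hf : ContDiffAt ℝ (n + 1) f x)
    (k : Fin d) : ContDiffAt ℝ n (fun z => pd f k z) x :=
  (hf.fderiv_right le_rfl).clm_apply contDiffAt_const

theorem pd2_comm {f : (Fin d → ℝ) → ℝ} (hf : ContDiffAt ℝ 2 f x) (i j : Fin d) :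
    pd2 f i j x = pd2 f j i x := by
  have hdiff : DifferentiableAt ℝ (fderiv ℝ f) x :=
    (hf.fderiv_right (m := 1) (by norm_num)).differentiableAt (by norm_num)
  have key : ∀ i j, pd2 f i j x = fderiv ℝ (fderiv ℝ f) x (Pi.single i 1) (Pi.single j 1) := by
    intro i j
    simp only [pd2, pd]
    rw [fderiv_clm_apply hdiff (differentiableAt_const _)]
    simp
  rw [key, key]
  exact hf.isSymmSndFDerivAt (by simp) _ _

end PartialDerivatives

section MatrixFields

open Filter Topology

variable {d : ℕ} {x : Fin d → ℝ}

theorem differentiableAt_det {A : (Fin d → ℝ) → Matrix (Fin d) (Fin d) ℝ}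
    (hA : ∀ i j, DifferentiableAt ℝ (fun z => A z i j) x) :
    DifferentiableAt ℝ (fun z => (A z).det) x := by
  simp only [Matrix.det_apply']
  fun_prop

theorem differentiableAt_inv_apply {A : (Fin d → ℝ) → Matrix (Fin d) (Fin d) ℝ}
    (hA : ∀ i j, DifferentiableAt ℝ (fun z => A z i j) x) (h0 : (A x).det ≠ 0) (i j : Fin d) :
    DifferentiableAt ℝ (fun z => (A z)⁻¹ i j) x := by
  simp only [Matrix.inv_def, Ring.inverse_eq_inv', Matrix.smul_apply, smul_eq_mul,
    Matrix.adjugate_apply]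
  refine ((differentiableAt_det hA).inv h0).mul (differentiableAt_det fun k l => ?_)
  simp only [Matrix.updateRow_apply]
  split_ifs
  · fun_prop
  · exact hA k l

/-- **Jacobi's formula** for the derivative of a determinant. -/
theorem pd_det {A : (Fin d → ℝ) → Matrix (Fin d) (Fin d) ℝ}
    (hA : ∀ i j, DifferentiableAt ℝ (fun z => A z i j) x) (k : Fin d) :
    pd (fun z => (A z).det) k x
      = ∑ i, ∑ j, (A x).adjugate j i * pd (fun z => A z i j) k x := by
  let D : ContinuousMultilinearMap ℝ (fun _ : Fin d => Fin d → ℝ) ℝ :=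
    { (Matrix.detRowAlternating (n := Fin d) (R := ℝ)).toMultilinearMap with
      cont := continuous_id.matrix_det }
  let A' : (Fin d → ℝ) → Fin d → Fin d → ℝ := A
  have hA' : HasFDerivAt A'
      (ContinuousLinearMap.pi fun i => ContinuousLinearMap.pi fun j =>
        fderiv ℝ (fun z => A z i j) x) x :=
    hasFDerivAt_pi.2 fun i => hasFDerivAt_pi.2 fun j => (hA i j).hasFDerivAt
  have h := (D.hasFDerivAt (A' x)).comp x hA'
  have h' : fderiv ℝ (fun z => (A z).det) x = _ := h.fderiv
  rw [pd, h']
  simp only [ContinuousLinearMap.comp_apply, ContinuousMultilinearMap.linearDeriv_apply]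
  refine Finset.sum_congr rfl fun i _ => ?_
  change ((A x).updateRow i fun j => pd (fun z => A z i j) k x).det = _
  rw [← Matrix.cramer_transpose_apply, Matrix.cramer_eq_adjugate_mulVec,
    ← Matrix.adjugate_transpose]
  rfl

/-- The **Piola identity**: the cofactor matrix of a Jacobian matrix is divergence free. -/
theorem sum_pd_det_mul_inv {K L : (Fin d → ℝ) → Matrix (Fin d) (Fin d) ℝ}
    (hK : ∀ i j, DifferentiableAt ℝ (fun z => K z i j) x)
    (hL : ∀ i j, DifferentiableAt ℝ (fun z => L z i j) x)
    (hLK : ∀ᶠ z in 𝓝 x, L z * K z = 1)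
    (hcurl : ∀ i b c, pd (fun z => K z i c) b x = pd (fun z => K z i b) c x) (j : Fin d) :
    ∑ b, pd (fun z => (K z).det * L z b j) b x = 0 := by
  have hx : L x * K x = 1 := hLK.self_of_nhds
  have hKL : K x * L x = 1 := mul_eq_one_comm.1 hx
  have hadj : (K x).adjugate = (K x).det • L x := by
    calc (K x).adjugate = (K x).adjugate * (K x * L x) := by rw [hKL, mul_one]
      _ = (K x).det • L x := by
        rw [← mul_assoc, Matrix.adjugate_mul, Matrix.smul_mul, one_mul]
  have hdL : ∀ b, pd (fun z => L z b j) b x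
      = -∑ i, ∑ c, L x b i * pd (fun z => K z i c) b x * L x c j := by
    intro b
    have hzero : ∀ c, ∑ i, (pd (fun z => L z b i) b x * K x i c
        + L x b i * pd (fun z => K z i c) b x) = 0 := by
      intro c
      have hone : pd (fun z => ∑ i, L z b i * K z i c) b x = 0 := by
        rw [pd_congr (h := fun _ => (1 : Matrix (Fin d) (Fin d) ℝ) b c)]
        · simp [pd]
        · filter_upwards [hLK] with z hz
          rw [← hz, Matrix.mul_apply]
      rw [pd_sum (f := fun i z => L z b i * K z i c) (fun i _ => (hL b i).mul (hK i c))] at hone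
      simpa only [pd_mul (hL b _) (hK _ c)] using hone
    have hcontr : ∑ c, (∑ i, (pd (fun z => L z b i) b x * K x i c
        + L x b i * pd (fun z => K z i c) b x)) * L x c j = 0 := by
      simp [hzero]
    have hcollapse : ∑ c, ∑ i, pd (fun z => L z b i) b x * K x i c * L x c j
        = pd (fun z => L z b j) b x := by
      rw [Finset.sum_comm]
      calc _ = ∑ i, pd (fun z => L z b i) b x * (K x * L x) i j := by
            simp only [Matrix.mul_apply, Finset.mul_sum, mul_assoc]
        _ = _ := by simp [hKL, Matrix.one_apply]
    simp only [Finset.sum_mul, add_mul, Finset.sum_add_distrib] at hcontr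
    rw [hcollapse, Finset.sum_comm] at hcontr
    linarith
  have hterm : ∀ b, pd (fun z => (K z).det * L z b j) b x
      = (K x).det * ((∑ i, ∑ c, L x c i * pd (fun z => K z i c) b x * L x b j)
        - ∑ i, ∑ c, L x b i * pd (fun z => K z i c) b x * L x c j) := by
    intro b
    rw [pd_mul (differentiableAt_det hK) (hL b j), pd_det hK, hdL, hadj]
    simp only [Matrix.smul_apply, smul_eq_mul, mul_add, Finset.mul_sum, Finset.sum_mul, mul_neg,
      sub_eq_add_neg, mul_assoc]
  simp only [hterm]
  rw [← Finset.mul_sum, Finset.sum_sub_distrib, mul_eq_zero, sub_eq_zero]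
  right
  rw [Finset.sum_comm]
  conv_rhs => rw [Finset.sum_comm]
  refine Finset.sum_congr rfl fun i _ => ?_
  rw [Finset.sum_comm]
  refine Finset.sum_congr rfl fun c _ => Finset.sum_congr rfl fun b _ => ?_
  rw [hcurl i b c]

theorem exists_abs_eventually_eq_mul {f : (Fin d → ℝ) → ℝ} (hf : ContinuousAt f x)
    (h0 : f x ≠ 0) : ∃ σ : ℝ, ∀ᶠ z in 𝓝 x, |f z| = σ * f z := by
  rcases h0.lt_or_gt with h | h
  · refine ⟨-1, ?_⟩
    filter_upwards [hf.eventually_lt_const h] with z hz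
    rw [abs_of_neg hz, neg_one_mul]
  · refine ⟨1, ?_⟩
    filter_upwards [hf.eventually_const_lt h] with z hz
    rw [abs_of_pos hz, one_mul]

end MatrixFields

section MetricTransformation

open Filter Topology

variable {d : ℕ}

/-- The Jacobian matrix `(∂f^a/∂x^i)(x)`. -/
noncomputable def jacobianMatrix (f : (Fin d → ℝ) → (Fin d → ℝ)) (x : Fin d → ℝ) :
    Matrix (Fin d) (Fin d) ℝ :=
  Matrix.of fun a i => pd (fun z => f z a) i x

theorem jacobianMatrix_apply (f : (Fin d → ℝ) → (Fin d → ℝ)) (x : Fin d → ℝ) (a i : Fin d) :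
    jacobianMatrix f x a i = pd (fun z => f z a) i x := rfl

theorem metricP_eq_mul (ψ : (Fin d → ℝ) → (Fin d → ℝ))
    (g : (Fin d → ℝ) → Matrix (Fin d) (Fin d) ℝ) (y : Fin d → ℝ) :
    metricP d ψ g y = (jacobianMatrix ψ y).transpose * g (ψ y) * jacobianMatrix ψ y := by
  ext a b
  simp only [metricP, Matrix.of_apply, Matrix.mul_apply, Matrix.transpose_apply,
    jacobianMatrix_apply, Finset.sum_mul]
  rw [Finset.sum_comm]

theorem jacobianMatrix_mul_of_leftInverse {φ ψ : (Fin d → ℝ) → (Fin d → ℝ)} {y : Fin d → ℝ}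
    (hφ : DifferentiableAt ℝ φ (ψ y)) (hψ : DifferentiableAt ℝ ψ y)
    (hφψ : ∀ᶠ z in 𝓝 y, φ (ψ z) = z) :
    jacobianMatrix φ (ψ y) * jacobianMatrix ψ y = 1 := by
  ext a b
  rw [← pd_coord (x := y), ← pd_congr (f := fun z => φ (ψ z) a)
    (by filter_upwards [hφψ] with z hz; rw [hz])]
  rw [pd_comp (f := fun w => φ w a) (differentiableAt_pi.1 hφ a) hψ]
  rfl

theorem eventually_jacobianMatrix_mul {φ ψ : (Fin d → ℝ) → (Fin d → ℝ)} {y : Fin d → ℝ}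
    (hφ : ContDiffAt ℝ 2 φ (ψ y)) (hψ : ContDiffAt ℝ 2 ψ y)
    (hφψ : ∀ᶠ z in 𝓝 y, φ (ψ z) = z) :
    ∀ᶠ z in 𝓝 y, jacobianMatrix φ (ψ z) * jacobianMatrix ψ z = 1 := by
  filter_upwards [hφψ.eventually_nhds, hψ.eventually (by norm_num),
    hψ.continuousAt.eventually (hφ.eventually (by norm_num))] with z hz hψz hφz
  exact jacobianMatrix_mul_of_leftInverse (hφz.differentiableAt (by norm_num))
    (hψz.differentiableAt (by norm_num)) hz

theorem differentiableAt_jacobianMatrix {f : (Fin d → ℝ) → (Fin d → ℝ)} {x : Fin d → ℝ}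
    (hf : ContDiffAt ℝ 2 f x) (a i : Fin d) :
    DifferentiableAt ℝ (fun z => jacobianMatrix f z a i) x :=
  (contDiffAt_pd (n := 1) (contDiffAt_pi.1 hf a) i).differentiableAt (by norm_num)

theorem sqrt_det_mul_inv_congruence {J K G : Matrix (Fin d) (Fin d) ℝ} (hG : G.det ≠ 0)
    (hJK : J * K = 1) (a b : Fin d) :
    √(K.transpose * G * K).det * (K.transpose * G * K)⁻¹ a b
      = ∑ j, |K.det| * (J b j * ∑ i, √G.det * G⁻¹ i j * J a i) := by
  have hKJ : K * J = 1 := mul_eq_one_comm.1 hJK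
  have hinv : (K.transpose * G * K)⁻¹ = J * G⁻¹ * J.transpose := by
    refine Matrix.inv_eq_right_inv ?_
    calc K.transpose * G * K * (J * G⁻¹ * J.transpose)
        = K.transpose * G * (K * J) * G⁻¹ * J.transpose := by simp only [mul_assoc]
      _ = K.transpose * (G * G⁻¹) * J.transpose := by simp only [hKJ, mul_one, mul_assoc]
      _ = 1 := by
        rw [Matrix.mul_nonsing_inv _ (isUnit_iff_ne_zero.2 hG), mul_one, ← Matrix.transpose_mul,
          hJK, Matrix.transpose_one]
  have hdet : √(K.transpose * G * K).det = |K.det| * √G.det := by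
    rw [Matrix.det_mul, Matrix.det_mul, Matrix.det_transpose,
      show K.det * G.det * K.det = K.det ^ 2 * G.det by ring, Real.sqrt_mul (sq_nonneg _),
      Real.sqrt_sq_eq_abs]
  rw [hinv, hdet, Matrix.mul_apply]
  simp only [Matrix.mul_apply, Matrix.transpose_apply, Finset.mul_sum, Finset.sum_mul]
  refine Finset.sum_congr rfl fun j _ => Finset.sum_congr rfl fun i _ => ?_
  ring

/-- The divergence transforms as a density: the Piola transform of `h` has divergence
`det K` times that of `h`. -/
theorem sum_pd_piola {φ ψ : (Fin d → ℝ) → (Fin d → ℝ)} {y : Fin d → ℝ}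
    (hφ : ContDiffAt ℝ 2 φ (ψ y)) (hψ : ContDiffAt ℝ 2 ψ y)
    (hφψ : ∀ᶠ z in 𝓝 y, φ (ψ z) = z)
    {h : Fin d → (Fin d → ℝ) → ℝ} (hh : ∀ j, DifferentiableAt ℝ (h j) (ψ y)) :
    ∑ b, ∑ j, pd (fun z => (jacobianMatrix ψ z).det * jacobianMatrix φ (ψ z) b j * h j (ψ z)) b y
      = (jacobianMatrix ψ y).det * ∑ j, pd (h j) j (ψ y) := by
  have hψd : DifferentiableAt ℝ ψ y := hψ.differentiableAt (by norm_num)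
  have hK := differentiableAt_jacobianMatrix hψ
  have hJ := differentiableAt_jacobianMatrix hφ
  have hL : ∀ a i, DifferentiableAt ℝ (fun z => jacobianMatrix φ (ψ z) a i) y := fun a i =>
    (hJ a i).comp (f := ψ) y hψd
  have hLK := eventually_jacobianMatrix_mul hφ hψ hφψ
  have hKL : jacobianMatrix ψ y * jacobianMatrix φ (ψ y) = 1 :=
    mul_eq_one_comm.1 hLK.self_of_nhds
  have hpiola := sum_pd_det_mul_inv hK hL hLK
    fun i b c => pd2_comm (contDiffAt_pi.1 hψ i) b c
  have hdet := differentiableAt_det hK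
  have hterm : ∀ b j,
      pd (fun z => (jacobianMatrix ψ z).det * jacobianMatrix φ (ψ z) b j * h j (ψ z)) b y
      = pd (fun z => (jacobianMatrix ψ z).det * jacobianMatrix φ (ψ z) b j) b y * h j (ψ y)
        + (jacobianMatrix ψ y).det * ∑ k, pd (h j) k (ψ y) *
          (jacobianMatrix ψ y k b * jacobianMatrix φ (ψ y) b j) := by
    intro b j
    rw [pd_mul (f := fun z => (jacobianMatrix ψ z).det * jacobianMatrix φ (ψ z) b j)
      (h := fun z => h j (ψ z)) (hdet.mul (hL b j)) ((hh j).comp (f := ψ) y hψd),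
      pd_comp (hh j) hψd]
    simp only [Finset.mul_sum, jacobianMatrix_apply]
    congr 1
    refine Finset.sum_congr rfl fun k _ => ?_
    ring
  rw [Finset.sum_comm, Finset.mul_sum]
  refine Finset.sum_congr rfl fun j _ => ?_
  simp only [hterm]
  rw [Finset.sum_add_distrib, ← Finset.sum_mul, hpiola, zero_mul, zero_add, ← Finset.mul_sum,
    Finset.sum_comm]
  simp only [← Finset.mul_sum, ← Matrix.mul_apply, hKL]
  simp [Matrix.one_apply]

/-- The quantum spurious drift transforms by the second-order (Itô) rule. -/
theorem quantumDrift_metricP (hbar m : ℝ) {φ ψ : (Fin d → ℝ) → (Fin d → ℝ)}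
    {g : (Fin d → ℝ) → Matrix (Fin d) (Fin d) ℝ} {y : Fin d → ℝ}
    (hφ : ContDiffAt ℝ 2 φ (ψ y)) (hψ : ContDiffAt ℝ 2 ψ y)
    (hφψ : ∀ᶠ z in 𝓝 y, φ (ψ z) = z)
    (hg : ∀ i j, DifferentiableAt ℝ (fun x => g x i j) (ψ y))
    (hsymm : (g (ψ y)).IsSymm) (hpos : 0 < (g (ψ y)).det) (a : Fin d) :
    quantumDrift d hbar m (metricP d ψ g) y a
      = ∑ i, pd (fun z => φ z a) i (ψ y) * quantumDrift d hbar m g (ψ y) i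
        + hbar / (2 * m) *
          ∑ i, ∑ j, (g (ψ y))⁻¹ i j * pd2 (fun z => φ z a) i j (ψ y) := by
  have hψd : DifferentiableAt ℝ ψ y := hψ.differentiableAt (by norm_num)
  have hK := differentiableAt_jacobianMatrix hψ
  have hJ := differentiableAt_jacobianMatrix hφ
  have hL : ∀ a i, DifferentiableAt ℝ (fun z => jacobianMatrix φ (ψ z) a i) y := fun a i =>
    (hJ a i).comp (f := ψ) y hψd
  have hLK := eventually_jacobianMatrix_mul hφ hψ hφψ
  have hdetK : (jacobianMatrix ψ y).det ≠ 0 :=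
    (Matrix.isUnit_det_of_left_inverse hLK.self_of_nhds).ne_zero
  obtain ⟨σ, hσ⟩ := exists_abs_eventually_eq_mul (differentiableAt_det hK).continuousAt hdetK
  have hdetg := differentiableAt_det hg
  have hs : DifferentiableAt ℝ (fun x => √(g x).det) (ψ y) := hdetg.sqrt hpos.ne'
  have hw : ∀ i j, DifferentiableAt ℝ (fun x => √(g x).det * (g x)⁻¹ i j) (ψ y) := fun i j =>
    hs.mul (differentiableAt_inv_apply hg hpos.ne' i j)
  set h : Fin d → (Fin d → ℝ) → ℝ := fun j x =>
    ∑ i, √(g x).det * (g x)⁻¹ i j * jacobianMatrix φ x a i with h_def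
  have hh : ∀ j, DifferentiableAt ℝ (h j) (ψ y) := fun j =>
    DifferentiableAt.fun_sum fun i _ => (hw i j).mul (hJ a i)
  have hdens : ∀ b, pd (fun z => √(metricP d ψ g z).det * (metricP d ψ g z)⁻¹ a b) b y
      = σ * ∑ j, pd (fun z =>
          (jacobianMatrix ψ z).det * jacobianMatrix φ (ψ z) b j * h j (ψ z)) b y := by
    intro b
    have hd : ∀ j, DifferentiableAt ℝ (fun z =>
        (jacobianMatrix ψ z).det * jacobianMatrix φ (ψ z) b j * h j (ψ z)) y := fun j =>
      ((differentiableAt_det hK).mul (hL b j)).mul ((hh j).comp (f := ψ) y hψd)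
    rw [← pd_sum (f := fun j z =>
        (jacobianMatrix ψ z).det * jacobianMatrix φ (ψ z) b j * h j (ψ z)) (fun j _ => hd j),
      ← pd_const_mul σ (DifferentiableAt.fun_sum fun j _ => hd j)]
    refine pd_congr ?_ b
    filter_upwards [hLK, hσ, hψd.continuousAt.eventually
      (hdetg.continuousAt.eventually_ne hpos.ne')] with z hz hσz hgz
    rw [metricP_eq_mul, sqrt_det_mul_inv_congruence hgz hz, hσz, Finset.mul_sum]
    refine Finset.sum_congr rfl fun j _ => ?_
    rw [h_def]
    ring
  have hdiv : ∑ j, pd (h j) j (ψ y)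
      = (∑ i, pd (fun z => φ z a) i (ψ y) * ∑ k, pd (fun x => √(g x).det * (g x)⁻¹ i k) k (ψ y))
        + √(g (ψ y)).det * ∑ i, ∑ j, (g (ψ y))⁻¹ i j * pd2 (fun z => φ z a) i j (ψ y) := by
    have hj : ∀ j, pd (h j) j (ψ y)
        = ∑ i, (pd (fun x => √(g x).det * (g x)⁻¹ i j) j (ψ y) * jacobianMatrix φ (ψ y) a i
          + √(g (ψ y)).det * (g (ψ y))⁻¹ i j * pd2 (fun z => φ z a) j i (ψ y)) := by
      intro j
      rw [h_def, pd_sum (f := fun i x => √(g x).det * (g x)⁻¹ i j * jacobianMatrix φ x a i)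
        (fun i _ => (hw i j).mul (hJ a i))]
      exact Finset.sum_congr rfl fun i _ => pd_mul (hw i j) (hJ a i) j
    simp only [hj, Finset.sum_add_distrib, Finset.mul_sum]
    congr 1
    · rw [Finset.sum_comm]
      refine Finset.sum_congr rfl fun i _ => Finset.sum_congr rfl fun k _ => ?_
      rw [jacobianMatrix_apply, mul_comm]
    · refine Finset.sum_congr rfl fun i _ => Finset.sum_congr rfl fun k _ => ?_
      rw [← hsymm.inv.apply i k, mul_assoc]
  have hsqrt : √(metricP d ψ g y).det = σ * (jacobianMatrix ψ y).det * √(g (ψ y)).det := by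
    rw [metricP_eq_mul, Matrix.det_mul, Matrix.det_mul, Matrix.det_transpose,
      ← hσ.self_of_nhds, mul_right_comm, ← sq, Real.sqrt_mul (sq_nonneg _), Real.sqrt_sq_eq_abs]
  have hσK : σ * (jacobianMatrix ψ y).det ≠ 0 := by
    rw [← hσ.self_of_nhds]
    exact abs_ne_zero.2 hdetK
  have hs0 : √(g (ψ y)).det ≠ 0 := (Real.sqrt_pos.2 hpos).ne'
  simp only [quantumDrift, hdens]
  rw [← Finset.mul_sum, sum_pd_piola hφ hψ hφψ hh, hsqrt, hdiv]
  have hpull : ∑ i, pd (fun z => φ z a) i (ψ y) * (hbar / (2 * m) * (√(g (ψ y)).det)⁻¹ *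
      ∑ k, pd (fun x => √(g x).det * (g x)⁻¹ i k) k (ψ y))
      = hbar / (2 * m) * (√(g (ψ y)).det)⁻¹ * ∑ i, pd (fun z => φ z a) i (ψ y) *
        ∑ k, pd (fun x => √(g x).det * (g x)⁻¹ i k) k (ψ y) := by
    rw [Finset.mul_sum]
    exact Finset.sum_congr rfl fun i _ => by ring
  rw [hpull]
  generalize (∑ i, pd (fun z => φ z a) i (ψ y) *
    ∑ k, pd (fun x => √(g x).det * (g x)⁻¹ i k) k (ψ y)) = A
  generalize (∑ i, ∑ j, (g (ψ y))⁻¹ i j * pd2 (fun z => φ z a) i j (ψ y)) = B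
  generalize √(g (ψ y)).det = s at *
  rw [← mul_assoc σ, mul_inv]
  generalize σ * (jacobianMatrix ψ y).det = c at *
  generalize hbar / (2 * m) = e
  field_simp

end MetricTransformation

/-- covariance of the quantum α = 0 time-slice action under the
quantum Ito formula: with
`Δy^a = (∂φ^a/∂x^i) Δx^i + (hbar/(2m)) g^{ij} (∂²φ^a/∂x^i∂x^j) Δt` (all at `x₀`),
(a) `Δy^a − Q'^a Δt = (∂φ^a/∂x^i)(Δx^i − Q^i Δt)`, and
(b) the α = 0 quantum time-slice action is invariant:
`(Δy − Q'Δt)ᵀ (m g'/(2hbarΔt)) (Δy − Q'Δt) + (Δt/hbar)V'(φ(x₀))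
  = (Δx − QΔt)ᵀ (m g/(2hbarΔt)) (Δx − QΔt) + (Δt/hbar)V(x₀)`. -/
theorem quantum_action_covariance (d : ℕ) (hd : 1 ≤ d)
    (hbar m : ℝ) (hhbar : 0 < hbar) (hm : 0 < m)
    (U V : Set (Fin d → ℝ)) (hU : IsOpen U) (hV : IsOpen V)
    (φ ψ : (Fin d → ℝ) → (Fin d → ℝ))
    (hφV : Set.MapsTo φ U V) (hψU : Set.MapsTo ψ V U)
    (hψφ : ∀ x ∈ U, ψ (φ x) = x) (hφψ : ∀ y ∈ V, φ (ψ y) = y)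
    (hφ : ContDiffOn ℝ 3 φ U) (hψ : ContDiffOn ℝ 3 ψ V)
    (g : (Fin d → ℝ) → Matrix (Fin d) (Fin d) ℝ)
    (hgsymm : ∀ x ∈ U, (g x).IsSymm) (hgpos : ∀ x ∈ U, (g x).PosDef)
    (hgC1 : ∀ i j, ContDiffOn ℝ 1 (fun x => g x i j) U)
    (Vpot : (Fin d → ℝ) → ℝ)
    (x₀ : Fin d → ℝ) (hx₀ : x₀ ∈ U) (Δt : ℝ) (hΔt : 0 < Δt)
    (Δx : Fin d → ℝ) (Δy : Fin d → ℝ)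
    (hΔy : ∀ a, Δy a =
      (∑ i, pd (fun z => φ z a) i x₀ * Δx i) +
      (hbar / (2 * m)) * (∑ i, ∑ j, (g x₀)⁻¹ i j * pd2 (fun z => φ z a) i j x₀) * Δt) :
    (∀ a, Δy a - quantumDrift d hbar m (metricP d ψ g) (φ x₀) a * Δt =
      ∑ i, pd (fun z => φ z a) i x₀ * (Δx i - quantumDrift d hbar m g x₀ i * Δt)) ∧
    ((∑ a, ∑ b,
        (Δy a - quantumDrift d hbar m (metricP d ψ g) (φ x₀) a * Δt) *
          (m * metricP d ψ g (φ x₀) a b / (2 * hbar * Δt)) *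
        (Δy b - quantumDrift d hbar m (metricP d ψ g) (φ x₀) b * Δt)) +
      (Δt / hbar) * Vpot (ψ (φ x₀)) =
      (∑ i, ∑ j,
        (Δx i - quantumDrift d hbar m g x₀ i * Δt) *
          (m * g x₀ i j / (2 * hbar * Δt)) *
        (Δx j - quantumDrift d hbar m g x₀ j * Δt)) +
      (Δt / hbar) * Vpot x₀) := by
  have hy₀ : φ x₀ ∈ V := hφV hx₀
  have hψy : ψ (φ x₀) = x₀ := hψφ x₀ hx₀
  have hφ2 : ContDiffAt ℝ 2 φ (ψ (φ x₀)) := by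
    rw [hψy]
    exact (hφ.contDiffAt (hU.mem_nhds hx₀)).of_le (by norm_num)
  have hψ2 : ContDiffAt ℝ 2 ψ (φ x₀) := (hψ.contDiffAt (hV.mem_nhds hy₀)).of_le (by norm_num)
  have hφψ' : ∀ᶠ z in nhds (φ x₀), φ (ψ z) = z := by
    filter_upwards [hV.mem_nhds hy₀] with z hz using hφψ z hz
  have hdrift : ∀ a, Δy a - quantumDrift d hbar m (metricP d ψ g) (φ x₀) a * Δt =
      ∑ i, pd (fun z => φ z a) i x₀ * (Δx i - quantumDrift d hbar m g x₀ i * Δt) := by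
    intro a
    have h := quantumDrift_metricP hbar m hφ2 hψ2 hφψ' (g := g)
      (fun i j => by
        rw [hψy]
        exact ((hgC1 i j).contDiffAt (hU.mem_nhds hx₀)).differentiableAt (by norm_num))
      (by rw [hψy]; exact hgsymm x₀ hx₀) (by rw [hψy]; exact (hgpos x₀ hx₀).det_pos) a
    rw [hψy] at h
    rw [h, hΔy]
    simp only [mul_sub, Finset.sum_sub_distrib, add_mul, Finset.sum_mul, ← mul_assoc]
    ring
  refine ⟨hdrift, ?_⟩
  rw [hψy]
  congr 1
  simp only [hdrift]
  have hJK := (eventually_jacobianMatrix_mul hφ2 hψ2 hφψ').self_of_nhds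
  have hKJ := mul_eq_one_comm.1 hJK
  rw [hψy] at hJK hKJ
  have hmetric : (jacobianMatrix φ x₀).transpose * metricP d ψ g (φ x₀) * jacobianMatrix φ x₀
      = g x₀ := by
    rw [metricP_eq_mul, hψy]
    calc _ = (jacobianMatrix ψ (φ x₀) * jacobianMatrix φ x₀).transpose * g x₀ *
          (jacobianMatrix ψ (φ x₀) * jacobianMatrix φ x₀) := by
          simp only [Matrix.transpose_mul, mul_assoc]
      _ = g x₀ := by simp [hKJ]
  have hquad : ∀ (G : Matrix (Fin d) (Fin d) ℝ) (v : Fin d → ℝ),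
      ∑ i, ∑ j, v i * (m * G i j / (2 * hbar * Δt)) * v j
        = m / (2 * hbar * Δt) * (v ⬝ᵥ G.mulVec v) := by
    intro G v
    simp only [dotProduct, Matrix.mulVec, Finset.mul_sum]
    refine Finset.sum_congr rfl fun i _ => Finset.sum_congr rfl fun j _ => ?_
    ring
  rw [hquad (g x₀) fun i => Δx i - quantumDrift d hbar m g x₀ i * Δt, ← hmetric]
  refine (hquad _ ((jacobianMatrix φ x₀).mulVec
    fun i => Δx i - quantumDrift d hbar m g x₀ i * Δt)).trans ?_
  rw [← Matrix.mulVec_mulVec, ← Matrix.mulVec_mulVec,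
    Matrix.dotProduct_mulVec _ (Matrix.transpose _), Matrix.vecMul_transpose]
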